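/- Let f_i : ℝ^d → ℝ be convex, differentiable and L_i-smooth, and let f = (1/n) Σ_{i=1}^n f_i be convex and L_f-smooth. Let S be a group sampling with marginals p_i ∈ (0,1] and isolated index set 𝓘. Then for all x, y ∈ ℝ^d: E_S ‖(1/n) Σ_{i∈S} (1/p_i)(∇f_i(x) − ∇f_i(y)) − (∇f(x) − ∇f(y))‖² ≤ (2/n) max{ max_{i∈𝓘} (1/p_i − 1) L_i , max_{i∉𝓘} L_i/p_i } · (f(x) − f(y) − ⟨∇f(y), x − y⟩). -/

import Mathlib

open scoped RealInnerProductSpace BigOperators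


lemma aux_descent {E : Type*} [NormedAddCommGroup E] [InnerProductSpace ℝ E] [CompleteSpace E]
    (f : E → ℝ) (f' : E → E) (hg : ∀ x, HasGradientAt f (f' x) x) (L : ℝ)
    (hs : ∀ x y, ‖f' x - f' y‖ ≤ L * ‖x - y‖) (x v : E) :
    f (x + v) ≤ f x + ⟪f' x, v⟫ + L / 2 * ‖v‖ ^ 2 := by
  have hd : ∀ s : ℝ, HasDerivAt
      (fun s : ℝ => f (x + s • v) - s * ⟪f' x, v⟫ - L / 2 * s ^ 2 * ‖v‖ ^ 2)
      (⟪f' (x + s • v), v⟫ - ⟪f' x, v⟫ - L * s * ‖v‖ ^ 2) s := by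
    intro s
    have h1 : HasDerivAt (fun s : ℝ => x + s • v) v s := by
      simpa using ((hasDerivAt_id s).smul_const v).const_add x
    have h2 : HasDerivAt (fun s : ℝ => f (x + s • v)) ⟪f' (x + s • v), v⟫ s := by
      have := (hg (x + s • v)).hasFDerivAt.comp_hasDerivAt s h1
      simp only [InnerProductSpace.toDual_apply_apply] at this
      exact this
    have h3 : HasDerivAt (fun s : ℝ => s * ⟪f' x, v⟫) ⟪f' x, v⟫ s := by
      simpa using (hasDerivAt_id s).mul_const ⟪f' x, v⟫
    have h4 : HasDerivAt (fun s : ℝ => L / 2 * s ^ 2 * ‖v‖ ^ 2) (L * s * ‖v‖ ^ 2) s := by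
      have := (((hasDerivAt_pow 2 s).const_mul (L / 2)).mul_const (‖v‖ ^ 2))
      refine this.congr_deriv ?_
      norm_num only [Nat.cast_ofNat, pow_one]
      ring
    exact (h2.sub h3).sub h4
  have hanti : AntitoneOn
      (fun s : ℝ => f (x + s • v) - s * ⟪f' x, v⟫ - L / 2 * s ^ 2 * ‖v‖ ^ 2) (Set.Icc 0 1) := by
    apply antitoneOn_of_deriv_nonpos (convex_Icc 0 1)
    · exact fun s _ => (hd s).continuousAt.continuousWithinAt
    · exact fun s _ => (hd s).differentiableAt.differentiableWithinAt
    · intro s hs'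
      rw [interior_Icc] at hs'
      rw [(hd s).deriv, ← inner_sub_left]
      have h1 := real_inner_le_norm (f' (x + s • v) - f' x) v
      have h2 := hs (x + s • v) x
      rw [add_sub_cancel_left, norm_smul, Real.norm_of_nonneg hs'.1.le] at h2
      have h3 := mul_le_mul_of_nonneg_right h2 (norm_nonneg v)
      nlinarith
  have := hanti (Set.left_mem_Icc.2 zero_le_one) (Set.right_mem_Icc.2 zero_le_one) zero_le_one
  simp at this
  linarith

lemma aux_convex {E : Type*} [NormedAddCommGroup E] [InnerProductSpace ℝ E] [CompleteSpace E]
    (f : E → ℝ) (f' : E → E) (hg : ∀ x, HasGradientAt f (f' x) x)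
    (hc : ConvexOn ℝ Set.univ f) (x y : E) :
    0 ≤ f x - f y - ⟪f' y, x - y⟫ := by
  have h1 : HasDerivAt (fun s : ℝ => AffineMap.lineMap y x s) (x - y) 0 :=
    AffineMap.hasDerivAt_lineMap
  have h2 : HasDerivAt (fun s : ℝ => f (AffineMap.lineMap y x s)) ⟪f' y, x - y⟫ 0 := by
    have h := hg (AffineMap.lineMap y x (0:ℝ))
    have := h.hasFDerivAt.comp_hasDerivAt (0:ℝ) h1
    simp only [InnerProductSpace.toDual_apply_apply, AffineMap.lineMap_apply_zero] at this
    exact this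
  have hcc : ConvexOn ℝ Set.univ (fun s : ℝ => f (AffineMap.lineMap y x s)) := by
    have := hc.comp_affineMap (AffineMap.lineMap (k := ℝ) y x)
    rw [Set.preimage_univ] at this
    exact this
  have := hcc.le_slope_of_hasDerivAt (Set.mem_univ 0) (Set.mem_univ 1) zero_lt_one h2
  simp [slope_def_field] at this
  linarith

lemma aux_coco {E : Type*} [NormedAddCommGroup E] [InnerProductSpace ℝ E] [CompleteSpace E]
    (f : E → ℝ) (f' : E → E) (hg : ∀ x, HasGradientAt f (f' x) x) (L : ℝ) (hL : 0 ≤ L)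
    (hs : ∀ x y, ‖f' x - f' y‖ ≤ L * ‖x - y‖)
    (hc : ConvexOn ℝ Set.univ f) (x y : E) :
    ‖f' x - f' y‖ ^ 2 ≤ 2 * L * (f x - f y - ⟪f' y, x - y⟫) := by
  rcases hL.eq_or_lt with h0 | hpos
  · have h := hs x y
    rw [← h0, zero_mul] at h
    have : ‖f' x - f' y‖ = 0 := le_antisymm h (norm_nonneg _)
    rw [this, ← h0]; simp
  · set a := f' x - f' y with ha
    have h1 := aux_descent f f' hg L hs x (-(L⁻¹ • a))
    have h2 := aux_convex f f' hg hc (x + -(L⁻¹ • a)) y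
    have e1 : x + -(L⁻¹ • a) - y = (x - y) - L⁻¹ • a := by abel
    rw [e1, inner_sub_right, inner_smul_right] at h2
    rw [inner_neg_right, inner_smul_right, norm_neg, norm_smul, mul_pow,
      Real.norm_of_nonneg (inv_nonneg.2 hL)] at h1
    have e2 : ⟪f' x, a⟫ - ⟪f' y, a⟫ = ‖a‖ ^ 2 := by
      rw [← inner_sub_left, ← ha, real_inner_self_eq_norm_sq]
    have e3 : L / 2 * (L⁻¹ ^ 2 * ‖a‖ ^ 2) = L⁻¹ * ‖a‖ ^ 2 / 2 := by field_simp
    have e4 : L⁻¹ * ⟪f' x, a⟫ - L⁻¹ * ⟪f' y, a⟫ = L⁻¹ * ‖a‖ ^ 2 := by rw [← e2]; ring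
    have h5 : L⁻¹ * ‖a‖ ^ 2 ≤ 2 * (f x - f y - ⟪f' y, x - y⟫) := by linarith
    have h6 := mul_le_mul_of_nonneg_left h5 hL
    rw [← mul_assoc, mul_inv_cancel₀ hpos.ne', one_mul] at h6
    linarith

/-- Second-moment identity. -/
lemma aux_moment {E : Type*} [NormedAddCommGroup E] [InnerProductSpace ℝ E] {n t : ℕ}
    (a : Fin n → E) (p : Fin n → ℝ) (hp0 : ∀ i, 0 < p i) (g : Fin n → Fin t)
    (pC : Finset (Fin n) → ℝ) (hpCsum : ∑ C, pC C = 1)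
    (hmarg : ∀ i, ∑ C ∈ Finset.univ.filter (fun C => i ∈ C), pC C = p i)
    (hsame : ∀ i j : Fin n, i ≠ j → g i = g j →
      ∑ C ∈ Finset.univ.filter (fun C => i ∈ C ∧ j ∈ C), pC C = 0)
    (hdiff : ∀ i j : Fin n, g i ≠ g j →
      ∑ C ∈ Finset.univ.filter (fun C => i ∈ C ∧ j ∈ C), pC C = p i * p j) :
    ∑ C, pC C * ‖∑ i ∈ C, (p i)⁻¹ • a i - ∑ i, a i‖ ^ 2
      = ∑ i, (p i)⁻¹ * ‖a i‖ ^ 2 - ∑ k, ‖∑ i, if g i = k then a i else 0‖ ^ 2 := by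
  set w : Finset (Fin n) → Fin n → ℝ := fun C i => (if i ∈ C then (p i)⁻¹ else 0) - 1 with hw
  have hW : ∀ i j, ∑ C, pC C * (w C i * w C j)
      = (if i = j then (p i)⁻¹ else 0) - (if g i = g j then 1 else 0) := by
    intro i j
    have e : ∀ C, pC C * (w C i * w C j) =
        (if i ∈ C ∧ j ∈ C then pC C else 0) * ((p i)⁻¹ * (p j)⁻¹)
        - (if i ∈ C then pC C else 0) * (p i)⁻¹ - (if j ∈ C then pC C else 0) * (p j)⁻¹ + pC C := by
      intro C
      by_cases h1 : i ∈ C <;> by_cases h2 : j ∈ C <;> simp [hw, h1, h2] <;> ring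
    simp_rw [e]
    rw [Finset.sum_add_distrib, Finset.sum_sub_distrib, Finset.sum_sub_distrib,
      ← Finset.sum_mul, ← Finset.sum_mul, ← Finset.sum_mul, ← Finset.sum_filter,
      ← Finset.sum_filter, ← Finset.sum_filter, hmarg, hmarg, hpCsum]
    have hi := (hp0 i).ne'
    have hj := (hp0 j).ne'
    by_cases hij : i = j
    · subst hij
      simp only [and_self, hmarg, if_true]
      field_simp
      ring
    · by_cases hgg : g i = g j
      · rw [hsame i j hij hgg]
        simp [hij, hgg, hi, hj]
      · rw [hdiff i j hgg]
        simp only [hij, hgg, if_false]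
        field_simp
        ring
  have hN : ∀ (c : Fin n → ℝ), ‖∑ i, c i • a i‖ ^ 2 = ∑ i, ∑ j, (c i * c j) * ⟪a i, a j⟫ := by
    intro c
    rw [← real_inner_self_eq_norm_sq, sum_inner]
    refine Finset.sum_congr rfl fun i _ => ?_
    rw [inner_sum]
    refine Finset.sum_congr rfl fun j _ => ?_
    rw [real_inner_smul_left, real_inner_smul_right]; ring
  have hL : ∀ C, ∑ i ∈ C, (p i)⁻¹ • a i - ∑ i, a i = ∑ i, w C i • a i := by
    intro C
    simp only [hw, sub_smul, one_smul, Finset.sum_sub_distrib, ite_smul, zero_smul]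
    simp
  have hR : ∀ k, ∑ i, (if g i = k then a i else 0)
      = ∑ i, (if g i = k then (1:ℝ) else 0) • a i := by
    intro k
    simp [ite_smul]
  have hsq : ∑ k, ‖∑ i, if g i = k then a i else 0‖ ^ 2
      = ∑ i, ∑ j, (if g i = g j then 1 else 0) * ⟪a i, a j⟫ := by
    simp_rw [hR, hN]
    rw [Finset.sum_comm]
    refine Finset.sum_congr rfl fun i _ => ?_
    rw [Finset.sum_comm]
    refine Finset.sum_congr rfl fun j _ => ?_
    rw [← Finset.sum_mul]
    congr 1
    simp [eq_comm]
  have hdiag : ∑ i, (p i)⁻¹ * ‖a i‖ ^ 2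
      = ∑ i, ∑ j, (if i = j then (p i)⁻¹ else 0) * ⟪a i, a j⟫ := by
    refine Finset.sum_congr rfl fun i _ => ?_
    simp
  rw [hsq, hdiag, ← Finset.sum_sub_distrib]
  simp_rw [← Finset.sum_sub_distrib, ← sub_mul, ← hW, hL, hN, Finset.mul_sum, Finset.sum_mul]
  rw [Finset.sum_comm]
  refine Finset.sum_congr rfl fun i _ => ?_
  rw [Finset.sum_comm]
  refine Finset.sum_congr rfl fun j _ => ?_
  refine Finset.sum_congr rfl fun C _ => ?_
  ring

/-- Lemma F.3(ii) of the paper: bound on the constant ℒ₂ for group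
sampling with `θ^i_S = 1/p_i`.  An index `i` is isolated if its group is `{i}`;
the empty supremum is interpreted (as in `Real.sSup`) as `0`. -/
theorem L2_group_sampling
    {d n t : ℕ}
    (f : Fin n → EuclideanSpace ℝ (Fin d) → ℝ)
    (f' : Fin n → EuclideanSpace ℝ (Fin d) → EuclideanSpace ℝ (Fin d))
    (hgrad : ∀ i x, HasGradientAt (f i) (f' i x) x)
    (L : Fin n → ℝ) (hL0 : ∀ i, 0 ≤ L i)
    (hconv : ∀ i, ConvexOn ℝ Set.univ (f i))
    (hsmooth : ∀ i, LipschitzWith (Real.toNNReal (L i)) (f' i))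
    (fbar : EuclideanSpace ℝ (Fin d) → ℝ)
    (hfbar : ∀ u, fbar u = (n : ℝ)⁻¹ * ∑ i, f i u)
    (fgrad : EuclideanSpace ℝ (Fin d) → EuclideanSpace ℝ (Fin d))
    (hfgrad : ∀ u, fgrad u = (n : ℝ)⁻¹ • ∑ i, f' i u)
    (Lf : ℝ) (hLf0 : 0 ≤ Lf)
    (hfconv : ConvexOn ℝ Set.univ fbar)
    (hfsmooth : LipschitzWith (Real.toNNReal Lf) fgrad)
    -- marginals and groups
    (p : Fin n → ℝ) (hp0 : ∀ i, 0 < p i) (hp1 : ∀ i, p i ≤ 1)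
    (G : Fin t → Finset (Fin n))
    (hGdisj : ∀ j k, j ≠ k → Disjoint (G j) (G k))
    (hGcover : ∀ i : Fin n, ∃ j, i ∈ G j)
    (hGsum : ∀ j, ∑ i ∈ G j, p i ≤ 1)
    -- the group sampling distribution
    (pC : Finset (Fin n) → ℝ) (hpC : ∀ C, 0 ≤ pC C) (hpCsum : ∑ C, pC C = 1)
    (hmarg : ∀ i, ∑ C ∈ Finset.univ.filter (fun C => i ∈ C), pC C = p i)
    (hsame : ∀ i j : Fin n, i ≠ j → (∃ k, i ∈ G k ∧ j ∈ G k) →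
      ∑ C ∈ Finset.univ.filter (fun C => i ∈ C ∧ j ∈ C), pC C = 0)
    (hdiff : ∀ i j : Fin n, ¬ (∃ k, i ∈ G k ∧ j ∈ G k) →
      ∑ C ∈ Finset.univ.filter (fun C => i ∈ C ∧ j ∈ C), pC C = p i * p j)
    (x y : EuclideanSpace ℝ (Fin d)) :
    ∑ C, pC C *
        ‖(n : ℝ)⁻¹ • ∑ i ∈ C, (p i)⁻¹ • (f' i x - f' i y) - (fgrad x - fgrad y)‖ ^ 2
      ≤ 2 / (n : ℝ) * max
            (sSup ((fun i => (1 / p i - 1) * L i) '' {i : Fin n | ∃ k, G k = {i}}))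
            (sSup ((fun i => L i / p i) '' {i : Fin n | ¬ ∃ k, G k = {i}}))
          * (fbar x - fbar y - ⟪fgrad y, x - y⟫) := by
  classical
  set a : Fin n → EuclideanSpace ℝ (Fin d) := fun i => f' i x - f' i y with ha
  set D : Fin n → ℝ := fun i => f i x - f i y - ⟪f' i y, x - y⟫ with hD
  have hD0 : ∀ i, 0 ≤ D i := fun i => aux_convex (f i) (f' i) (hgrad i) (hconv i) x y
  have hcoco : ∀ i, ‖a i‖ ^ 2 ≤ 2 * L i * D i := by
    intro i
    refine aux_coco (f i) (f' i) (hgrad i) (L i) (hL0 i) ?_ (hconv i) x y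
    intro u v
    have := (hsmooth i).dist_le_mul u v
    rwa [dist_eq_norm, dist_eq_norm, Real.coe_toNNReal _ (hL0 i)] at this
  have hDbar : fbar x - fbar y - ⟪fgrad y, x - y⟫ = (n : ℝ)⁻¹ * ∑ i, D i := by
    rw [hfbar, hfbar, hfgrad, real_inner_smul_left, sum_inner]
    simp only [hD, Finset.sum_sub_distrib]
    ring
  choose g hgm using hGcover
  have hgu : ∀ i k, i ∈ G k → k = g i := by
    intro i k hk
    by_contra hne
    exact Finset.disjoint_left.1 (hGdisj k (g i) hne) hk (hgm i)
  have hex : ∀ i j, (∃ k, i ∈ G k ∧ j ∈ G k) ↔ g i = g j := by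
    intro i j
    constructor
    · rintro ⟨k, h1, h2⟩
      rw [← hgu i k h1, ← hgu j k h2]
    · intro h
      exact ⟨g i, hgm i, h ▸ hgm j⟩
  have hmom := aux_moment a p hp0 g pC hpCsum hmarg
    (fun i j hij h => hsame i j hij ((hex i j).2 h))
    (fun i j h => hdiff i j (fun h' => h ((hex i j).1 h')))
  set iso : Finset (Fin n) := Finset.univ.filter (fun i => ∃ k, G k = {i}) with hiso
  have hisoG : ∀ i, i ∈ iso → G (g i) = {i} := by
    intro i hi
    obtain ⟨k, hk⟩ := (Finset.mem_filter.1 hi).2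
    have : k = g i := hgu i k (by rw [hk]; simp)
    rw [← this, hk]
  have hisog : ∀ i ∈ iso, ∀ j, g j = g i ↔ j = i := by
    intro i hi j
    constructor
    · intro h
      have := hgm j
      rw [h, hisoG i hi] at this
      simpa using this
    · rintro rfl; rfl
  have hsq : ∑ i ∈ iso, ‖a i‖ ^ 2 ≤ ∑ k, ‖∑ i, if g i = k then a i else 0‖ ^ 2 := by
    have e : ∀ i ∈ iso, ‖a i‖ ^ 2 = ‖∑ j, if g j = g i then a j else 0‖ ^ 2 := by
      intro i hi
      simp [hisog i hi]
    rw [Finset.sum_congr rfl e,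
      ← Finset.sum_image (s := iso) (g := g)
        (f := fun k => ‖∑ j, if g j = k then a j else 0‖ ^ 2)]
    · exact Finset.sum_le_sum_of_subset_of_nonneg (Finset.subset_univ _)
        (fun _ _ _ => by positivity)
    · intro i _ j hj hij
      exact (hisog j hj i).1 hij
  set M := max
      (sSup ((fun i => (1 / p i - 1) * L i) '' {i : Fin n | ∃ k, G k = {i}}))
      (sSup ((fun i => L i / p i) '' {i : Fin n | ¬ ∃ k, G k = {i}})) with hM
  have hterm : ∀ i, ((p i)⁻¹ - if i ∈ iso then 1 else 0) * ‖a i‖ ^ 2 ≤ 2 * M * D i := by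
    intro i
    have hinv : 1 ≤ (p i)⁻¹ := (one_le_inv₀ (hp0 i)).2 (hp1 i)
    have hc0 : 0 ≤ (p i)⁻¹ - (if i ∈ iso then (1:ℝ) else 0) := by
      split_ifs <;> linarith
    have hcM : ((p i)⁻¹ - (if i ∈ iso then (1:ℝ) else 0)) * L i ≤ M := by
      by_cases hi : i ∈ iso
      · refine le_trans (le_csSup (Set.toFinite _).bddAbove ?_) (le_max_left _ _)
        refine ⟨i, (Finset.mem_filter.1 hi).2, ?_⟩
        simp [hi]
      · refine le_trans (le_csSup (Set.toFinite _).bddAbove ?_) (le_max_right _ _)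
        refine ⟨i, fun h => hi (Finset.mem_filter.2 ⟨Finset.mem_univ _, h⟩), ?_⟩
        simp [hi, div_eq_inv_mul]
    calc _ ≤ ((p i)⁻¹ - if i ∈ iso then 1 else 0) * (2 * L i * D i) :=
          mul_le_mul_of_nonneg_left (hcoco i) hc0
      _ = 2 * ((((p i)⁻¹ - if i ∈ iso then 1 else 0) * L i) * D i) := by ring
      _ ≤ 2 * (M * D i) := by
          have := mul_le_mul_of_nonneg_right hcM (hD0 i)
          linarith
      _ = _ := by ring
  have hmain : ∑ C, pC C * ‖∑ i ∈ C, (p i)⁻¹ • a i - ∑ i, a i‖ ^ 2 ≤ 2 * M * ∑ i, D i := by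
    rw [hmom, Finset.mul_sum]
    refine le_trans ?_ (Finset.sum_le_sum fun i _ => hterm i)
    have : ∑ i, ((p i)⁻¹ - if i ∈ iso then 1 else 0) * ‖a i‖ ^ 2
        = ∑ i, (p i)⁻¹ * ‖a i‖ ^ 2 - ∑ i ∈ iso, ‖a i‖ ^ 2 := by
      simp only [sub_mul, Finset.sum_sub_distrib, ite_mul, one_mul, zero_mul]
      congr 1
      rw [Finset.sum_ite_mem, Finset.univ_inter]
    rw [this]
    linarith
  have hlhs : ∀ C : Finset (Fin n),
      pC C * ‖(n : ℝ)⁻¹ • ∑ i ∈ C, (p i)⁻¹ • (f' i x - f' i y) - (fgrad x - fgrad y)‖ ^ 2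
      = (n : ℝ)⁻¹ ^ 2 * (pC C * ‖∑ i ∈ C, (p i)⁻¹ • a i - ∑ i, a i‖ ^ 2) := by
    intro C
    have : (n : ℝ)⁻¹ • ∑ i ∈ C, (p i)⁻¹ • (f' i x - f' i y) - (fgrad x - fgrad y)
        = (n : ℝ)⁻¹ • (∑ i ∈ C, (p i)⁻¹ • a i - ∑ i, a i) := by
      rw [hfgrad, hfgrad, ← smul_sub, ← Finset.sum_sub_distrib, ← smul_sub]
    rw [this, norm_smul, mul_pow, Real.norm_of_nonneg (by positivity)]
    ring
  simp_rw [hlhs]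
  rw [← Finset.mul_sum, hDbar]
  calc _ ≤ (n : ℝ)⁻¹ ^ 2 * (2 * M * ∑ i, D i) :=
        mul_le_mul_of_nonneg_left hmain (by positivity)
    _ = _ := by ring
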